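/- Let X be a complex Banach space and let A be the generator of a C₀-semigroup (T(t))_{t≥0} on X. Suppose that σ(A) is contained in the open left half-plane {z ∈ ℂ : Re z < 0}, and that M : [0,∞) → (0,∞) is a continuous non-decreasing function with M(s) → ∞ as s → ∞ such that, for some δ ∈ (0,1], δ·M(s) ≤ sup_{|r|≤s} 1/dist(ir, σ(A)) ≤ sup_{|r|≤s} ‖R(ir,A)‖ ≤ M(s) for all s ≥ 0. If ‖T(t)A⁻¹‖ = O(1/M⁻¹(ct)) as t → ∞ for some c > 0, then M has positive increase. -/

import Mathlib

open Filter Topology MeasureTheory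

noncomputable section

/-- `T` is a (one-parameter) `C₀`-semigroup on `X`, indexed by `t ≥ 0`. -/
structure IsC0Semigroup {X : Type*} [NormedAddCommGroup X] [NormedSpace ℂ X]
    (T : ℝ → X →L[ℂ] X) : Prop where
  map_zero : T 0 = 1
  map_add : ∀ s t : ℝ, 0 ≤ s → 0 ≤ t → T (s + t) = T s ∘L T t
  strong_continuity : ∀ x : X, ContinuousOn (fun t => T t x) (Set.Ici (0 : ℝ))

/-- `A` (a closed, densely defined, partially defined linear operator) is the
infinitesimal generator of the semigroup `T`. -/
structure IsGenerator {X : Type*} [NormedAddCommGroup X] [NormedSpace ℂ X]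
    (T : ℝ → X →L[ℂ] X) (A : X →ₗ.[ℂ] X) : Prop where
  dense_domain : Dense (A.domain : Set X)
  mem_domain_iff : ∀ x : X, x ∈ A.domain ↔
    ∃ y : X, Tendsto (fun t : ℝ => t⁻¹ • (T t x - x)) (𝓝[>] (0 : ℝ)) (𝓝 y)
  tendsto_generator : ∀ x : A.domain,
    Tendsto (fun t : ℝ => t⁻¹ • (T t (x : X) - (x : X))) (𝓝[>] (0 : ℝ)) (𝓝 (A x))

/-- `R` is the resolvent operator `R(z, A) = (z I - A)⁻¹` of `A` at the point `z`;
in particular `z` belongs to the resolvent set of `A`. -/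
structure IsResolvent {X : Type*} [NormedAddCommGroup X] [NormedSpace ℂ X]
    (A : X →ₗ.[ℂ] X) (z : ℂ) (R : X →L[ℂ] X) : Prop where
  mem_domain : ∀ x : X, R x ∈ A.domain
  right_inv : ∀ x : X, z • R x - A ⟨R x, mem_domain x⟩ = x
  left_inv : ∀ x : A.domain, R (z • (x : X) - A x) = (x : X)

/-- The spectrum `σ(A)` of the partially defined operator `A`: the set of `z ∈ ℂ`
at which no (bounded, everywhere defined) resolvent operator for `A` exists. -/
def pmSpectrum {X : Type*} [NormedAddCommGroup X] [NormedSpace ℂ X]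
    (A : X →ₗ.[ℂ] X) : Set ℂ :=
  {z : ℂ | ¬∃ R : X →L[ℂ] X, IsResolvent A z R}

/-- `M : [a, ∞) → (0, ∞)` has positive increase: there are `α > 0`, `c ∈ (0,1]` and
`s₀ ≥ a` with `s₀ > 0` such that `M (λ s) / M s ≥ c λ^α` for all `λ ≥ 1`, `s ≥ s₀`. -/
def HasPosIncrease (a : ℝ) (M : ℝ → ℝ) : Prop :=
  ∃ α : ℝ, 0 < α ∧ ∃ c : ℝ, c ∈ Set.Ioc (0 : ℝ) 1 ∧ ∃ s₀ : ℝ, a ≤ s₀ ∧ 0 < s₀ ∧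
    ∀ lam : ℝ, 1 ≤ lam → ∀ s : ℝ, s₀ ≤ s → c * lam ^ α ≤ M (lam * s) / M s

/-- The right-continuous right-inverse `M⁻¹ t = sup {r ≥ a : M r ≤ t}` of a
continuous non-decreasing function `M` on `[a, ∞)` with `M s → ∞` as `s → ∞`. -/
def rcInv (a : ℝ) (M : ℝ → ℝ) (t : ℝ) : ℝ :=
  sSup {r : ℝ | a ≤ r ∧ M r ≤ t}

section PositiveIncrease

/-- A doubling property at a fixed scale implies positive increase. -/
theorem hasPosIncrease_of_two_mul_le {M : ℝ → ℝ} (hMpos : ∀ s : ℝ, 0 ≤ s → 0 < M s)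
    (hMmono : ∀ s t : ℝ, 0 ≤ s → s ≤ t → M s ≤ M t) {l s₀ : ℝ} (hl : 1 < l) (hs₀ : 0 < s₀)
    (h : ∀ s, s₀ ≤ s → 2 * M s ≤ M (l * s)) : HasPosIncrease 0 M := by
  have hl0 : 0 < l := zero_lt_one.trans hl
  have hiter : ∀ (n : ℕ) (s : ℝ), s₀ ≤ s → 2 ^ n * M s ≤ M (l ^ n * s) := by
    intro n
    induction n with
    | zero => intro s _; simp
    | succ n ih =>
      intro s hs
      have h1 := ih (l * s) (by nlinarith)
      have h2 := h s hs
      calc 2 ^ (n + 1) * M s = 2 ^ n * (2 * M s) := by ring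
        _ ≤ 2 ^ n * M (l * s) := by gcongr
        _ ≤ M (l ^ n * (l * s)) := h1
        _ = M (l ^ (n + 1) * s) := by ring_nf
  have hlog : 0 < Real.log l := Real.log_pos hl
  have hα : 0 < Real.log 2 / Real.log l := div_pos (Real.log_pos one_lt_two) hlog
  have hlα : l ^ (Real.log 2 / Real.log l) = 2 := by
    rw [Real.rpow_def_of_pos hl0, mul_div_cancel₀ _ hlog.ne', Real.exp_log two_pos]
  refine ⟨_, hα, 1 / 2, ⟨by norm_num, by norm_num⟩, s₀, hs₀.le, hs₀, fun lam hlam s hs => ?_⟩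
  obtain ⟨n, hn1, hn2⟩ := exists_nat_pow_near hlam hl
  have hs0 : 0 < s := hs₀.trans_le hs
  rw [le_div_iff₀ (hMpos s hs0.le)]
  have h1 : lam ^ (Real.log 2 / Real.log l) ≤ 2 ^ (n + 1) := by
    calc lam ^ (Real.log 2 / Real.log l)
        ≤ (l ^ (n + 1)) ^ (Real.log 2 / Real.log l) :=
          Real.rpow_le_rpow (by linarith) hn2.le hα.le
      _ = (l ^ (Real.log 2 / Real.log l)) ^ (n + 1) := by
          rw [← Real.rpow_natCast, ← Real.rpow_natCast, ← Real.rpow_mul hl0.le,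
            ← Real.rpow_mul hl0.le, mul_comm]
      _ = 2 ^ (n + 1) := by rw [hlα]
  have hM := hMpos s hs0.le
  calc 1 / 2 * lam ^ (Real.log 2 / Real.log l) * M s
      ≤ 1 / 2 * 2 ^ (n + 1) * M s := by gcongr
    _ = 2 ^ n * M s := by ring
    _ ≤ M (l ^ n * s) := hiter n s hs
    _ ≤ M (lam * s) := hMmono _ _ (by positivity) (by gcongr)

theorem le_rcInv_apply {M : ℝ → ℝ} (hMtop : Tendsto M atTop atTop) {s : ℝ} (hs : 0 ≤ s) :
    s ≤ rcInv 0 M (M s) := by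
  obtain ⟨b, hb⟩ := (hMtop.eventually (eventually_gt_atTop (M s))).exists_forall_of_atTop
  refine le_csSup ⟨b, fun r hr => ?_⟩ ⟨hs, le_rfl⟩
  by_contra! hbr
  exact (hb r hbr.le).not_ge hr.2

end PositiveIncrease

section Semigroup

variable {X : Type*} [NormedAddCommGroup X] [NormedSpace ℂ X] {T : ℝ → X →L[ℂ] X}
  {A : X →ₗ.[ℂ] X}

theorem IsC0Semigroup.tendsto_diff_quotient (hT : IsC0Semigroup T) (hA : IsGenerator T A)
    {s : ℝ} (hs : 0 ≤ s) (x : A.domain) :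
    Tendsto (fun h : ℝ => h⁻¹ • (T (s + h) x - T s x)) (𝓝[>] (0 : ℝ)) (𝓝 (T s (A x))) := by
  refine (((T s).continuous.tendsto _).comp (hA.tendsto_generator x)).congr' ?_
  filter_upwards [self_mem_nhdsWithin] with h hh
  have hsmul : ∀ y : X, T s (h⁻¹ • y) = h⁻¹ • T s y := fun y =>
    ((T s).restrictScalars ℝ).map_smul _ _
  simp [hT.map_add s h hs (le_of_lt hh), hsmul]

theorem IsC0Semigroup.map_mem_domain (hT : IsC0Semigroup T) (hA : IsGenerator T A)
    {s : ℝ} (hs : 0 ≤ s) (x : A.domain) :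
    ∃ h : T s x ∈ A.domain, A ⟨T s x, h⟩ = T s (A x) := by
  have hlim : Tendsto (fun h : ℝ => h⁻¹ • (T h (T s x) - T s x)) (𝓝[>] (0 : ℝ))
      (𝓝 (T s (A x))) := by
    refine (hT.tendsto_diff_quotient hA hs x).congr' ?_
    filter_upwards [self_mem_nhdsWithin] with h hh
    rw [add_comm, hT.map_add h s (le_of_lt hh) hs]
    rfl
  have hmem : T s x ∈ A.domain := (hA.mem_domain_iff _).2 ⟨_, hlim⟩
  exact ⟨hmem, tendsto_nhds_unique (hA.tendsto_generator ⟨_, hmem⟩) hlim⟩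

theorem IsC0Semigroup.hasDerivWithinAt (hT : IsC0Semigroup T) (hA : IsGenerator T A)
    {s : ℝ} (hs : 0 ≤ s) (x : A.domain) :
    HasDerivWithinAt (fun s => T s x) (T s (A x)) (Set.Ioi s) s := by
  rw [hasDerivWithinAt_iff_tendsto_slope' (by simp)]
  have hsub : Tendsto (fun r : ℝ => r - s) (𝓝[>] s) (𝓝[>] 0) := by
    refine tendsto_nhdsWithin_iff.2 ⟨?_, ?_⟩
    · have : Tendsto (fun r : ℝ => r - s) (𝓝 s) (𝓝 (s - s)) := by
        exact (continuous_id.sub continuous_const).tendsto s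
      rw [sub_self] at this
      exact this.mono_left nhdsWithin_le_nhds
    · filter_upwards [self_mem_nhdsWithin] with r hr
      exact sub_pos.2 (Set.mem_Ioi.1 hr)
  refine ((hT.tendsto_diff_quotient hA hs x).comp hsub).congr fun r => ?_
  simp [slope_def_module]

theorem IsC0Semigroup.exists_norm_le [CompleteSpace X] (hT : IsC0Semigroup T) (t : ℝ) :
    ∃ K : ℝ, ∀ s ∈ Set.Icc 0 t, ‖T s‖ ≤ K := by
  obtain ⟨K, hK⟩ := banach_steinhaus (g := fun s : Set.Icc (0 : ℝ) t => T s) fun x => by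
    obtain ⟨C, hC⟩ := isCompact_Icc.exists_bound_of_continuousOn
      ((hT.strong_continuity x).mono (Set.Icc_subset_Ici_self : Set.Icc 0 t ⊆ Set.Ici 0))
    exact ⟨C, fun s => hC s s.2⟩
  exact ⟨K, fun s hs => hK ⟨s, hs⟩⟩

theorem IsC0Semigroup.intervalIntegrable (hT : IsC0Semigroup T) (z : ℂ) {t : ℝ} (ht : 0 ≤ t)
    (x : X) : IntervalIntegrable (fun s : ℝ => Complex.exp (z * (t - s)) • T s x) volume 0 t := by
  refine ContinuousOn.intervalIntegrable ?_
  rw [Set.uIcc_of_le ht]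
  exact ContinuousOn.smul (by fun_prop) ((hT.strong_continuity x).mono Set.Icc_subset_Ici_self)

/-- The bounded operator `x ↦ ∫₀ᵗ e^{z(t-s)} T(s) x ds`. -/
theorem IsC0Semigroup.exists_convolution [CompleteSpace X] (hT : IsC0Semigroup T) (z : ℂ)
    {t : ℝ} (ht : 0 ≤ t) :
    ∃ V : X →L[ℂ] X, ∀ x, V x = ∫ s in (0 : ℝ)..t, Complex.exp (z * (t - s)) • T s x := by
  obtain ⟨K, hK⟩ := hT.exists_norm_le t
  obtain ⟨E, hE⟩ := (isCompact_Icc (a := (0 : ℝ)) (b := t)).exists_bound_of_continuousOn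
    (f := fun s : ℝ => Complex.exp (z * (t - s))) (by fun_prop)
  refine ⟨LinearMap.mkContinuous
    { toFun := fun x => ∫ s in (0 : ℝ)..t, Complex.exp (z * (t - s)) • T s x
      map_add' := fun x y => ?_
      map_smul' := fun a x => ?_ } (E * K * |t - 0|) fun x => ?_, fun x => rfl⟩
  · rw [← intervalIntegral.integral_add (hT.intervalIntegrable z ht x)
      (hT.intervalIntegrable z ht y)]
    simp
  · rw [RingHom.id_apply, ← intervalIntegral.integral_smul]
    simp [smul_comm a]
  · have h := intervalIntegral.norm_integral_le_of_norm_le_const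
      (f := fun s : ℝ => Complex.exp (z * (t - s)) • T s x) (a := 0) (b := t)
      (C := E * (K * ‖x‖)) fun s hs => by
        rw [Set.uIoc_of_le ht] at hs
        have hs' := Set.Ioc_subset_Icc_self hs
        rw [norm_smul]
        exact mul_le_mul (hE s hs') ((T s).le_of_opNorm_le (hK s hs') x) (norm_nonneg _)
          ((norm_nonneg _).trans (hE s hs'))
    calc _ ≤ _ := h
      _ = _ := by ring

/-- A form of the spectral inclusion theorem: if `A` is invertible with inverse `B`, then the
semigroup orbit of `B` is bounded below by the values `e^{t z} / z` at spectral points `z`. -/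
theorem IsC0Semigroup.norm_exp_div_le [CompleteSpace X] (hT : IsC0Semigroup T)
    (hA : IsGenerator T A) {B : X →L[ℂ] X} (hmem : ∀ x, B x ∈ A.domain)
    (hAB : ∀ x, A ⟨B x, hmem x⟩ = x) (hBA : ∀ x : A.domain, B (A x) = x)
    {z : ℂ} (hz0 : z ≠ 0) (hz : z ∈ pmSpectrum A) {t : ℝ} (ht : 0 ≤ t) :
    ‖Complex.exp (z * t) / z‖ ≤ ‖T t ∘L B‖ := by
  by_contra! hlt
  refine hz ?_
  have hcommT : ∀ s, 0 ≤ s → ∀ x, T s (B x) = B (T s x) := by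
    intro s hs x
    obtain ⟨h1, h2⟩ := hT.map_mem_domain hA hs ⟨B x, hmem x⟩
    rw [hAB] at h2
    have h3 := hBA ⟨T s (B x), h1⟩
    rw [h2] at h3
    exact h3.symm
  obtain ⟨V, hV⟩ := hT.exists_convolution z ht
  have hVB : V * B = B * V := by
    ext x
    change V (B x) = B (V x)
    rw [hV, hV, ← ContinuousLinearMap.intervalIntegral_comp_comm _ (hT.intervalIntegrable z ht x)]
    refine intervalIntegral.integral_congr fun s hs => ?_
    rw [Set.uIcc_of_le ht] at hs
    simp [hcommT s hs.1]
  have hkey : V * (1 - z • B) = T t * B - Complex.exp (z * t) • B := by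
    ext y
    have hcont : ContinuousOn (fun s : ℝ => Complex.exp (z * (t - s)) • T s (B y))
        (Set.Icc 0 t) :=
      ContinuousOn.smul (by fun_prop)
        ((hT.strong_continuity (B y)).mono Set.Icc_subset_Ici_self)
    have hderiv : ∀ s ∈ Set.Ioo 0 t,
        HasDerivWithinAt (fun s : ℝ => Complex.exp (z * (t - s)) • T s (B y))
          (Complex.exp (z * (t - s)) • T s (y - z • B y)) (Set.Ioi s) s := by
      intro s hs
      have h1 : HasDerivAt (fun s : ℝ => Complex.exp (z * (t - s)))
          (Complex.exp (z * (t - s)) * (z * (0 - 1))) s :=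
        ((((hasDerivAt_const s (t : ℂ)).sub (hasDerivAt_id s).ofReal_comp)).const_mul z).cexp
      have h2 := hT.hasDerivWithinAt hA hs.1.le ⟨B y, hmem y⟩
      rw [hAB] at h2
      refine (h1.hasDerivWithinAt.smul h2).congr_deriv ?_
      simp only [map_sub, map_smul, smul_sub, smul_smul]
      simp only [zero_sub, mul_neg, mul_one, neg_smul]
      abel
    have h := intervalIntegral.integral_eq_sub_of_hasDeriv_right_of_le ht hcont hderiv
      (hT.intervalIntegrable z ht _)
    change V (y - z • B y) = T t (B y) - Complex.exp (z * t) • B y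
    rw [hV, h]
    simp [hT.map_zero]
  set S : X →L[ℂ] X := (Complex.exp (z * t) / z) • 1 - T t * B with hS
  have hfac : S = ((Complex.exp (z * t) / z) • 1 - V) * (1 - z • B) := by
    rw [sub_mul, hkey, hS, smul_mul_assoc, one_mul, smul_sub, smul_smul, div_mul_cancel₀ _ hz0]
    abel
  have hSunit : IsUnit S := by
    have h1 : Complex.exp (z * t) / z ∈ resolventSet ℂ (T t * B) :=
      spectrum.mem_resolventSet_of_norm_lt_mul (lt_of_le_of_lt
        (mul_le_of_le_one_right (norm_nonneg _) ContinuousLinearMap.norm_id_le) hlt)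
    rwa [spectrum.mem_resolventSet_iff, Algebra.algebraMap_eq_smul_one] at h1
  have hcomm : Commute ((Complex.exp (z * t) / z) • (1 : X →L[ℂ] X) - V) (1 - z • B) := by
    have hc : Commute V B := hVB
    exact (Commute.smul_left (Commute.one_left _) _).sub_left
      ((Commute.one_right V).sub_right (hc.smul_right z))
  rw [hfac, hcomm.isUnit_mul_iff] at hSunit
  obtain ⟨u, hu⟩ := hSunit.2
  have hright : ∀ x, (1 - z • B) ((↑u⁻¹ : X →L[ℂ] X) x) = x := fun x => by
    rw [← hu]
    exact DFunLike.congr_fun u.mul_inv x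
  have hleft : ∀ x, (↑u⁻¹ : X →L[ℂ] X) ((1 - z • B) x) = x := fun x => by
    rw [← hu]
    exact DFunLike.congr_fun u.inv_mul x
  have hmem' : ∀ x, (-(B * (↑u⁻¹ : X →L[ℂ] X))) x ∈ A.domain := fun x =>
    A.domain.neg_mem (hmem _)
  refine ⟨-(B * (↑u⁻¹ : X →L[ℂ] X)), hmem', fun x => ?_, fun x => ?_⟩
  · have h1 : (⟨(-(B * (↑u⁻¹ : X →L[ℂ] X))) x, hmem' x⟩ : A.domain)
        = -⟨B ((↑u⁻¹ : X →L[ℂ] X) x), hmem _⟩ := rfl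
    rw [h1, A.map_neg, hAB]
    refine Eq.trans ?_ (hright x)
    change z • -(B ((↑u⁻¹ : X →L[ℂ] X) x)) - -((↑u⁻¹ : X →L[ℂ] X) x)
      = (↑u⁻¹ : X →L[ℂ] X) x - z • B ((↑u⁻¹ : X →L[ℂ] X) x)
    rw [smul_neg]
    abel
  · have h1 : z • (x : X) - A x = -((1 - z • B) (A x)) := by
      change _ = -(A x - z • B (A x))
      rw [hBA, neg_sub]
    rw [h1, map_neg]
    change - -(B ((↑u⁻¹ : X →L[ℂ] X) ((1 - z • B) (A x)))) = _
    rw [hleft, hBA, neg_neg]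

end Semigroup

/-- Let `X` be a complex Banach space and `A` the generator of a
`C₀`-semigroup `(T(t))` on `X`. Suppose `σ(A) ⊆ {Re z < 0}` and that `M : [0,∞) → (0,∞)`
is continuous, non-decreasing, with `M s → ∞`, such that for some `δ ∈ (0,1]`,
`δ M s ≤ sup_{|r| ≤ s} dist(i r, σ(A))⁻¹ ≤ sup_{|r| ≤ s} ‖R(i r, A)‖ ≤ M s` for all `s ≥ 0`.
If `‖T(t) A⁻¹‖ = O(1 / M⁻¹ (c t))` as `t → ∞` for some `c > 0`, then `M` has positive
increase. (Note `A⁻¹ = -R(0, A)`.) -/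
theorem statement4 {X : Type*} [NormedAddCommGroup X] [NormedSpace ℂ X] [CompleteSpace X]
    (T : ℝ → X →L[ℂ] X) (hT : IsC0Semigroup T)
    (A : X →ₗ.[ℂ] X) (hA : IsGenerator T A)
    (hspec : pmSpectrum A ⊆ {z : ℂ | z.re < 0})
    (Rop : ℝ → X →L[ℂ] X)
    (hRop : ∀ r : ℝ, IsResolvent A (Complex.I * (r : ℂ)) (Rop r))
    (M : ℝ → ℝ)
    (hMpos : ∀ s : ℝ, 0 ≤ s → 0 < M s)
    (hMcont : ContinuousOn M (Set.Ici (0 : ℝ)))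
    (hMmono : ∀ s t : ℝ, 0 ≤ s → s ≤ t → M s ≤ M t)
    (hMtop : Tendsto M atTop atTop)
    (δ : ℝ) (hδ : δ ∈ Set.Ioc (0 : ℝ) 1)
    (hchain : ∀ s : ℝ, 0 ≤ s →
      δ * M s ≤
          (⨆ r : {r : ℝ // |r| ≤ s},
            (Metric.infDist (Complex.I * ((r : ℝ) : ℂ)) (pmSpectrum A))⁻¹) ∧
      (⨆ r : {r : ℝ // |r| ≤ s},
            (Metric.infDist (Complex.I * ((r : ℝ) : ℂ)) (pmSpectrum A))⁻¹) ≤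
          (⨆ r : {r : ℝ // |r| ≤ s}, ‖Rop (r : ℝ)‖) ∧
      (⨆ r : {r : ℝ // |r| ≤ s}, ‖Rop (r : ℝ)‖) ≤ M s)
    (c : ℝ) (hc : 0 < c)
    (hO : ∃ C : ℝ, 0 < C ∧ ∃ t₀ : ℝ, ∀ t : ℝ, t₀ ≤ t →
      ‖T t ∘L (-(Rop 0))‖ ≤ C / rcInv 0 M (c * t)) :
    HasPosIncrease 0 M := by
  obtain ⟨hδ0, -⟩ := hδ
  obtain ⟨C, hC, t₀, hO⟩ := hO
  have hR : IsResolvent A 0 (Rop 0) := by simpa using hRop 0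
  have hmem : ∀ x, (-(Rop 0)) x ∈ A.domain := fun x => A.domain.neg_mem (hR.mem_domain x)
  have hAB : ∀ x, A ⟨(-(Rop 0)) x, hmem x⟩ = x := by
    intro x
    have h1 : (⟨(-(Rop 0)) x, hmem x⟩ : A.domain) = -⟨Rop 0 x, hR.mem_domain x⟩ := rfl
    have h2 := hR.right_inv x
    rw [zero_smul, zero_sub] at h2
    rw [h1, A.map_neg, h2]
  have hBA : ∀ x : A.domain, (-(Rop 0)) (A x) = x := by
    intro x
    have h2 := hR.left_inv x
    rw [zero_smul, zero_sub, map_neg] at h2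
    exact h2
  obtain ⟨s₁, hs₁⟩ := ((hMtop.eventually (eventually_ge_atTop (2 / δ))).and
    (hMtop.eventually (eventually_ge_atTop (c * t₀)))).exists_forall_of_atTop
  set l : ℝ := max 2 (2 * C * Real.exp (4 / (c * δ))) with hl
  have hl2 : 2 ≤ l := le_max_left _ _
  have hlC : 2 * C * Real.exp (4 / (c * δ)) ≤ l := le_max_right _ _
  refine hasPosIncrease_of_two_mul_le hMpos hMmono (l := l) (s₀ := max 1 s₁) (by linarith)
    (by positivity) fun s hs => ?_
  have hs1 : 1 ≤ s := (le_max_left _ _).trans hs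
  obtain ⟨hMδ, hMt⟩ := hs₁ s ((le_max_right _ _).trans hs)
  have hs0 : 0 ≤ s := by linarith
  have hMs := hMpos s hs0
  have hδM : 0 < δ * M s := mul_pos hδ0 hMs
  obtain ⟨z, hz, hzre, hznorm⟩ : ∃ z ∈ pmSpectrum A, -(2 / (δ * M s)) < z.re ∧ ‖z‖ ≤ 2 * s := by
    have : Nonempty {r : ℝ // |r| ≤ s} := ⟨⟨0, by simpa using hs0⟩⟩
    obtain ⟨⟨r, hr⟩, hr'⟩ := exists_lt_of_lt_ciSup
      (lt_of_lt_of_le (half_lt_self hδM) (hchain s hs0).1)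
    have hinv : 0 < (Metric.infDist (Complex.I * (r : ℂ)) (pmSpectrum A))⁻¹ :=
      (half_pos hδM).trans hr'
    have hpos := inv_pos.1 hinv
    have hne : (pmSpectrum A).Nonempty := by
      by_contra hempty
      rw [Set.not_nonempty_iff_eq_empty.1 hempty, Metric.infDist_empty] at hpos
      exact hpos.false
    have hdist : Metric.infDist (Complex.I * (r : ℂ)) (pmSpectrum A) < 2 / (δ * M s) := by
      rw [← inv_div]
      exact (lt_inv_comm₀ (half_pos hδM) hpos).1 hr'
    obtain ⟨z, hz, hzd⟩ := (Metric.infDist_lt_iff hne).1 hdist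
    rw [dist_eq_norm'] at hzd
    refine ⟨z, hz, ?_, ?_⟩
    · have h1 := (Complex.abs_re_le_norm (z - Complex.I * r)).trans_lt hzd
      have h2 : (z - Complex.I * r).re = z.re := by simp
      rw [h2] at h1
      exact (abs_lt.1 h1).1
    · have h1 : ‖z‖ ≤ ‖z - Complex.I * r‖ + ‖Complex.I * (r : ℂ)‖ := norm_le_norm_sub_add _ _
      have h2 : ‖Complex.I * (r : ℂ)‖ = |r| := by simp
      have h3 : 2 / (δ * M s) ≤ 1 := by
        rw [div_le_one hδM]
        rwa [div_le_iff₀' hδ0] at hMδ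
      linarith
  have hls : s ≤ l * s := by nlinarith
  have hls0 : 0 < l * s := by nlinarith
  have hMls := hMmono s (l * s) hs0 hls
  by_contra! hlt
  set t : ℝ := M (l * s) / c with ht
  have hct : c * t = M (l * s) := mul_div_cancel₀ _ hc.ne'
  have ht0 : 0 ≤ t := div_nonneg (hMs.le.trans hMls) hc.le
  have htt : t₀ ≤ t := by
    rw [ht, le_div_iff₀' hc]
    exact hMt.trans hMls
  have hz0 : z ≠ 0 := by
    rintro rfl
    simpa using hspec hz
  have h1 := hT.norm_exp_div_le hA hmem hAB hBA hz0 hz ht0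
  have h2 : C / rcInv 0 M (c * t) ≤ C / (l * s) := by
    rw [hct]
    exact div_le_div_of_nonneg_left hC.le hls0 (le_rcInv_apply hMtop hls0.le)
  have h3 := h1.trans ((hO t htt).trans h2)
  have hre : (z * (t : ℂ)).re = z.re * t := by simp
  rw [norm_div, Complex.norm_exp, hre, div_le_div_iff₀ (norm_pos_iff.2 hz0) hls0] at h3
  have h4 : -(4 / (c * δ)) < z.re * t := by
    have htpos : 0 < t := div_pos (hMs.trans_le hMls) hc
    have h5 : -(2 / (δ * M s)) * t < z.re * t := mul_lt_mul_of_pos_right hzre htpos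
    have h6 : 2 / (δ * M s) * t ≤ 2 / (δ * M s) * (2 * M s / c) := by
      rw [ht]
      gcongr
    have h7 : 2 / (δ * M s) * (2 * M s / c) = 4 / (c * δ) := by
      field_simp
      norm_num
    linarith
  have h8 : Real.exp (-(4 / (c * δ))) * (l * s) < C * (2 * s) :=
    calc Real.exp (-(4 / (c * δ))) * (l * s) < Real.exp (z.re * t) * (l * s) := by gcongr
      _ ≤ C * ‖z‖ := h3
      _ ≤ C * (2 * s) := by gcongr
  have h9 : C * (2 * s) ≤ Real.exp (-(4 / (c * δ))) * (l * s) :=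
    calc C * (2 * s) = Real.exp (-(4 / (c * δ))) * (2 * C * Real.exp (4 / (c * δ)) * s) := by
          rw [Real.exp_neg]
          field_simp
      _ ≤ _ := by gcongr
  exact h8.not_ge h9

end
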